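/- arXiv:0902.0538 — 3 statements merged into one kernel-verified Lean document; each statement's English description precedes it below -/
import Mathlib

section
/- (Commutator identity for the Lévy operator.) Let π be a positive σ-finite Borel measure on ℝᵈ∖{0} with ∫(|z|²·1_{|z|<1} + |z|·1_{|z|≥1}) dπ(z) < ∞. Let u : ℝᵈ → ℝ be bounded and C² with bounded gradient and bounded second derivative, and let η ∈ C²(ℝ). Then for every x ∈ ℝᵈ all integrals below converge absolutely and L[η∘u](x) − η'(u(x))·L[u](x) = ∫_{ℝᵈ∖{0}} (∫₀¹ (1−τ)·η''((1−τ)u(x) + τu(x+z)) dτ)·(u(x+z) − u(x))² dπ(z); in particular, if η is convex then L[η∘u](x) ≥ η'(u(x))·L[u](x). -/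
open MeasureTheory Set

noncomputable section

variable {d : ℕ}

/-- The Lévy operator `L[ψ](x) = ∫ [ψ(x+z) − ψ(x) − z·∇ψ(x)·1_{|z|<1}] dπ(z)`. -/
def levyOp (π : Measure (EuclideanSpace ℝ (Fin d)))
    (ψ : EuclideanSpace ℝ (Fin d) → ℝ) (x : EuclideanSpace ℝ (Fin d)) : ℝ :=
  ∫ z, (ψ (x + z) - ψ x -
    Set.indicator (Metric.ball (0 : EuclideanSpace ℝ (Fin d)) 1)
      (fun w => fderiv ℝ ψ x w) z) ∂π

/-- Taylor's formula of order two on the line, with integral remainder. -/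
theorem taylor_two_integral_remainder {f : ℝ → ℝ} (hf : ContDiff ℝ 2 f) (a b : ℝ) :
    (∫ τ in (0:ℝ)..1, (1 - τ) * deriv (deriv f) ((1 - τ) * a + τ * b)) * (b - a) ^ 2 =
      f b - f a - deriv f a * (b - a) := by
  have hf' : ContDiff ℝ 1 (deriv f) := hf.deriv' (n := 1)
  have hf'' : Continuous (deriv (deriv f)) := hf'.continuous_deriv le_rfl
  have hd (t : ℝ) : HasDerivAt f (deriv f t) t :=
    (hf.differentiable (by norm_num) t).hasDerivAt
  have hd' (t : ℝ) : HasDerivAt (deriv f) (deriv (deriv f) t) t :=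
    (hf'.differentiable (by norm_num) t).hasDerivAt
  have hF (τ : ℝ) : HasDerivAt
      (fun τ => (1 - τ) * (b - a) * deriv f ((1 - τ) * a + τ * b) + f ((1 - τ) * a + τ * b))
      ((1 - τ) * deriv (deriv f) ((1 - τ) * a + τ * b) * (b - a) ^ 2) τ := by
    have hone : HasDerivAt (fun τ : ℝ => 1 - τ) (-1) τ := (hasDerivAt_id τ).const_sub 1
    have hc : HasDerivAt (fun τ : ℝ => (1 - τ) * a + τ * b) (b - a) τ :=
      ((hone.mul_const a).add ((hasDerivAt_id τ).mul_const b)).congr_deriv (by ring)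
    exact (((hone.mul_const (b - a)).mul ((hd' _).comp τ hc)).add ((hd _).comp τ hc)).congr_deriv
      (by simp only [Function.comp_apply]; ring)
  rw [← intervalIntegral.integral_mul_const,
    intervalIntegral.integral_eq_sub_of_hasDerivAt (fun τ _ => hF τ)
      (Continuous.intervalIntegrable (by fun_prop) 0 1)]
  simp only [sub_self, zero_mul, sub_zero, one_mul, zero_add, add_zero]
  ring

/-- A bound on the second derivative controls the first-order Taylor remainder. -/
theorem norm_sub_sub_fderiv_le {E F : Type*} [NormedAddCommGroup E] [NormedSpace ℝ E]
    [NormedAddCommGroup F] [NormedSpace ℝ F] {u : E → F} (hu : ContDiff ℝ 2 u) {C : ℝ}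
    (hC : ∀ y, ‖fderiv ℝ (fderiv ℝ u) y‖ ≤ C) (x z : E) :
    ‖u (x + z) - u x - fderiv ℝ u x z‖ ≤ C * ‖z‖ ^ 2 := by
  have hC0 : 0 ≤ C := (norm_nonneg (fderiv ℝ (fderiv ℝ u) x)).trans (hC x)
  have hdu : Differentiable ℝ (fderiv ℝ u) :=
    (hu.fderiv_right (m := 1) (by norm_num)).differentiable (by norm_num)
  have hb : ∀ y ∈ Metric.closedBall x ‖z‖, ‖fderiv ℝ u y - fderiv ℝ u x‖ ≤ C * ‖z‖ := by
    intro y hy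
    refine (Convex.norm_image_sub_le_of_norm_fderiv_le (fun w _ => hdu w) (fun w _ => hC w)
      convex_univ (mem_univ x) (mem_univ y)).trans ?_
    gcongr
    exact mem_closedBall_iff_norm.1 hy
  have h := (convex_closedBall x ‖z‖).norm_image_sub_le_of_norm_fderiv_le'
    (fun y _ => hu.differentiable (by norm_num) y) hb
    (Metric.mem_closedBall_self (norm_nonneg z)) (y := x + z) (by simp)
  simpa [pow_two, mul_assoc] using h

/-- A measurable function dominated by a multiple of the Lévy weight `|z|² ∧ |z|` is integrable
with respect to a Lévy measure. -/
theorem integrable_of_le_levy_weight {E : Type*} [NormedAddCommGroup E] [MeasurableSpace E]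
    [BorelSpace E] {π : Measure E}
    (hπ : ∫⁻ z, ENNReal.ofReal (if ‖z‖ < 1 then ‖z‖ ^ 2 else ‖z‖) ∂π < ⊤) {f : E → ℝ}
    (hf : Measurable f) {C : ℝ}
    (hin : ∀ z, ‖z‖ < 1 → |f z| ≤ C * ‖z‖ ^ 2) (hout : ∀ z, 1 ≤ ‖z‖ → |f z| ≤ C * ‖z‖) :
    Integrable f π := by
  have hw : Integrable (fun z : E => if ‖z‖ < 1 then ‖z‖ ^ 2 else ‖z‖) π := by
    refine (lintegral_ofReal_ne_top_iff_integrable ?_ (.of_forall fun z => ?_)).1 hπ.ne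
    · exact (Measurable.ite (measurableSet_lt measurable_norm measurable_const)
        (measurable_norm.pow_const 2) measurable_norm).aestronglyMeasurable
    · split_ifs <;> positivity
  refine (hw.const_mul C).mono' hf.aestronglyMeasurable (.of_forall fun z => ?_)
  rw [Real.norm_eq_abs]
  split_ifs with h
  exacts [hin z h, hout z (not_lt.1 h)]

/-- **Commutator identity for the Lévy operator.** For a σ-finite Lévy measure `π` on
`ℝᵈ ∖ {0}` satisfying the Lévy integrability condition, a bounded `C²` function `u` with
bounded gradient and Hessian, and `η ∈ C²(ℝ)`, all the relevant integrals converge absolutely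
and
`L[η∘u](x) − η'(u(x))·L[u](x)
   = ∫ (∫₀¹ (1−τ)·η''((1−τ)u(x) + τ u(x+z)) dτ)·(u(x+z) − u(x))² dπ(z)`;
in particular, if `η` is convex then `L[η∘u](x) ≥ η'(u(x))·L[u](x)`. -/
theorem levyOp_commutator
    (π : Measure (EuclideanSpace ℝ (Fin d))) [SigmaFinite π]
    (hπ0 : π {0} = 0)
    (hπint : ∫⁻ z, ENNReal.ofReal
        (if ‖z‖ < 1 then ‖z‖ ^ 2 else ‖z‖) ∂π < ⊤)
    (u : EuclideanSpace ℝ (Fin d) → ℝ) (hu : ContDiff ℝ 2 u)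
    (Cu C₁ C₂ : ℝ)
    (hub : ∀ y, |u y| ≤ Cu)
    (hgrad : ∀ y, ‖fderiv ℝ u y‖ ≤ C₁)
    (hhess : ∀ y, ‖fderiv ℝ (fderiv ℝ u) y‖ ≤ C₂)
    (η : ℝ → ℝ) (hη : ContDiff ℝ 2 η)
    (x : EuclideanSpace ℝ (Fin d)) :
    Integrable (fun z => (η ∘ u) (x + z) - (η ∘ u) x -
        Set.indicator (Metric.ball (0 : EuclideanSpace ℝ (Fin d)) 1)
          (fun w => fderiv ℝ (η ∘ u) x w) z) π ∧
    Integrable (fun z => u (x + z) - u x -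
        Set.indicator (Metric.ball (0 : EuclideanSpace ℝ (Fin d)) 1)
          (fun w => fderiv ℝ u x w) z) π ∧
    Integrable (fun z =>
        (∫ τ in (0:ℝ)..1, (1 - τ) * deriv (deriv η) ((1 - τ) * u x + τ * u (x + z))) *
          (u (x + z) - u x) ^ 2) π ∧
    levyOp π (η ∘ u) x - deriv η (u x) * levyOp π u x =
      ∫ z, (∫ τ in (0:ℝ)..1, (1 - τ) * deriv (deriv η) ((1 - τ) * u x + τ * u (x + z))) *
        (u (x + z) - u x) ^ 2 ∂π ∧
    (ConvexOn ℝ Set.univ η → levyOp π (η ∘ u) x ≥ deriv η (u x) * levyOp π u x) := by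
  have hη' : ContDiff ℝ 1 (deriv η) := hη.deriv' (n := 1)
  have hη'' : Continuous (deriv (deriv η)) := hη'.continuous_deriv le_rfl
  have hCu : 0 ≤ Cu := (abs_nonneg _).trans (hub x)
  have hC₁ : 0 ≤ C₁ := (norm_nonneg _).trans (hgrad x)
  have hC₂ : 0 ≤ C₂ := (norm_nonneg (fderiv ℝ (fderiv ℝ u) x)).trans (hhess x)
  have hlip (z) : |u (x + z) - u x| ≤ C₁ * ‖z‖ := by
    simpa using Convex.norm_image_sub_le_of_norm_fderiv_le (𝕜 := ℝ)
      (fun y _ => hu.differentiable (by norm_num) y) (fun y _ => hgrad y) convex_univ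
      (mem_univ x) (mem_univ (x + z))
  have hI : Integrable (fun z => u (x + z) - u x -
      Set.indicator (Metric.ball (0 : EuclideanSpace ℝ (Fin d)) 1)
        (fun w => fderiv ℝ u x w) z) π := by
    refine integrable_of_le_levy_weight (C := C₁ + C₂) hπint ?_ (fun z hz => ?_) (fun z hz => ?_)
    · exact (Continuous.measurable (by have := hu.continuous; fun_prop)).sub
        ((fderiv ℝ u x).continuous.measurable.indicator measurableSet_ball)
    · rw [indicator_of_mem (by simpa using hz)]
      refine (norm_sub_sub_fderiv_le hu hhess x z).trans ?_
      gcongr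
      linarith
    · rw [indicator_of_notMem (by simpa using hz), sub_zero]
      refine (hlip z).trans ?_
      gcongr
      linarith
  obtain ⟨K, hK⟩ := (isCompact_Icc (a := -Cu) (b := Cu)).exists_bound_of_continuousOn
    hη''.continuousOn
  have hK0 : 0 ≤ K := (norm_nonneg _).trans (hK (u x) (abs_le.1 (hub x)))
  have hrem (z) : |∫ τ in (0:ℝ)..1,
      (1 - τ) * deriv (deriv η) ((1 - τ) * u x + τ * u (x + z))| ≤ K := by
    have h := intervalIntegral.norm_integral_le_of_norm_le_const (a := (0:ℝ)) (b := 1) (C := K)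
      (f := fun τ => (1 - τ) * deriv (deriv η) ((1 - τ) * u x + τ * u (x + z))) fun τ hτ => ?_
    · simpa using h
    rw [uIoc_of_le zero_le_one] at hτ
    have hmem : (1 - τ) * u x + τ * u (x + z) ∈ Icc (-Cu) Cu :=
      convex_Icc _ _ (abs_le.1 (hub x)) (abs_le.1 (hub (x + z)))
        (by linarith [hτ.2]) hτ.1.le (by ring)
    rw [norm_mul, Real.norm_of_nonneg (by linarith [hτ.2] : 0 ≤ 1 - τ)]
    calc (1 - τ) * ‖deriv (deriv η) ((1 - τ) * u x + τ * u (x + z))‖ ≤ 1 * K :=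
          mul_le_mul (by linarith [hτ.1]) (hK _ hmem) (norm_nonneg _) zero_le_one
      _ = K := one_mul K
  have hR : Integrable (fun z =>
      (∫ τ in (0:ℝ)..1, (1 - τ) * deriv (deriv η) ((1 - τ) * u x + τ * u (x + z))) *
        (u (x + z) - u x) ^ 2) π := by
    refine integrable_of_le_levy_weight (C := K * (C₁ ^ 2 + 2 * Cu * C₁)) hπint ?_
      (fun z hz => ?_) (fun z hz => ?_)
    · simp_rw [taylor_two_integral_remainder hη]
      have := hu.continuous
      have := hη.continuous
      exact Continuous.measurable (by fun_prop)
    · rw [abs_mul, abs_pow, mul_assoc]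
      refine mul_le_mul (hrem z) ?_ (by positivity) hK0
      calc |u (x + z) - u x| ^ 2 ≤ (C₁ * ‖z‖) ^ 2 := by gcongr; exact hlip z
        _ = C₁ ^ 2 * ‖z‖ ^ 2 := by ring
        _ ≤ (C₁ ^ 2 + 2 * Cu * C₁) * ‖z‖ ^ 2 := by
          gcongr
          exact le_add_of_nonneg_right (by positivity)
    · rw [abs_mul, abs_pow, mul_assoc]
      refine mul_le_mul (hrem z) ?_ (by positivity) hK0
      have h2 : |u (x + z) - u x| ≤ 2 * Cu :=
        (abs_sub _ _).trans (by linarith [hub x, hub (x + z)])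
      calc |u (x + z) - u x| ^ 2 = |u (x + z) - u x| * |u (x + z) - u x| := pow_two _
        _ ≤ 2 * Cu * (C₁ * ‖z‖) := mul_le_mul h2 (hlip z) (abs_nonneg _) (by positivity)
        _ = 2 * Cu * C₁ * ‖z‖ := by ring
        _ ≤ (C₁ ^ 2 + 2 * Cu * C₁) * ‖z‖ := by
          gcongr
          exact le_add_of_nonneg_left (by positivity)
  have hchain : fderiv ℝ (η ∘ u) x = deriv η (u x) • fderiv ℝ u x :=
    ((hη.differentiable (by norm_num) _).hasDerivAt.comp_hasFDerivAt x
      (hu.differentiable (by norm_num) x).hasFDerivAt).fderiv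
  have hsplit : (fun z => (η ∘ u) (x + z) - (η ∘ u) x -
      Set.indicator (Metric.ball (0 : EuclideanSpace ℝ (Fin d)) 1)
        (fun w => fderiv ℝ (η ∘ u) x w) z) = fun z =>
      (∫ τ in (0:ℝ)..1, (1 - τ) * deriv (deriv η) ((1 - τ) * u x + τ * u (x + z))) *
        (u (x + z) - u x) ^ 2 + deriv η (u x) * (u (x + z) - u x -
      Set.indicator (Metric.ball (0 : EuclideanSpace ℝ (Fin d)) 1)
        (fun w => fderiv ℝ u x w) z) := by
    ext z
    rw [taylor_two_integral_remainder hη, hchain]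
    by_cases hz : z ∈ Metric.ball (0 : EuclideanSpace ℝ (Fin d)) 1
    · simp only [indicator_of_mem hz, Function.comp_apply, smul_apply,
        smul_eq_mul]
      ring
    · simp only [indicator_of_notMem hz, Function.comp_apply]
      ring
  have heq : levyOp π (η ∘ u) x - deriv η (u x) * levyOp π u x =
      ∫ z, (∫ τ in (0:ℝ)..1, (1 - τ) * deriv (deriv η) ((1 - τ) * u x + τ * u (x + z))) *
        (u (x + z) - u x) ^ 2 ∂π := by
    rw [levyOp, levyOp, hsplit, integral_add hR (hI.const_mul _), integral_const_mul,
      add_sub_cancel_right]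
  refine ⟨hsplit ▸ hR.add (hI.const_mul _), hI, hR, heq, fun hconv => ?_⟩
  rw [ge_iff_le, ← sub_nonneg, heq]
  refine integral_nonneg fun z => ?_
  have hd : HasDerivAt η (deriv η (u x)) (u x) :=
    (hη.differentiable (by norm_num) (u x)).hasDerivAt
  simp only [Pi.zero_apply, taylor_two_integral_remainder hη]
  rcases lt_trichotomy (u x) (u (x + z)) with h | h | h
  · have := hconv.le_slope_of_hasDerivAt (mem_univ _) (mem_univ _) h hd
    rw [slope_def_field, le_div_iff₀ (sub_pos.2 h)] at this
    linarith
  · simp [← h]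
  · have := hconv.slope_le_of_hasDerivAt (mem_univ _) (mem_univ _) h hd
    rw [slope_def_field, div_le_iff₀ (sub_pos.2 h)] at this
    linarith
end
end

section
/- (Entropy identity for smooth solutions of the regularized equation.) Let ρ > 0, f ∈ C¹(ℝ;ℝᵈ), σ^a ∈ C¹(ℝ;ℝ^{d×K}), a = σ^a(σ^a)^tr, and let π be a positive σ-finite Borel measure on ℝᵈ∖{0} with ∫(|z|²·1_{|z|<1} + |z|·1_{|z|≥1}) dπ(z) < ∞. Suppose u : (0,T)×ℝᵈ → ℝ is bounded, C¹ in t and C² in x with bounded spatial derivatives up to second order, and solves pointwise ∂ₜu + div f(u) = div(a(u)∇u) + L[u] + ρΔu. Then for every η ∈ C²(ℝ), with q, r, ζ_{ik} defined by q' = η'f', r' = η'a, ζ_{ik}(z) = ∫₀^z σ^a_{ik}, the following identity holds pointwise: ∂ₜη(u) + div q(u) = Σ_{i,j=1}^d ∂²_{x_ix_j} r_{ij}(u) + L[η(u)] + ρΔη(u) − (ν¹ + ν² + ν³), where ν¹ = ρ·η''(u)|∇u|², ν² = η''(u)·Σ_{k=1}^K (Σ_{i=1}^d ∂_{x_i}ζ_{ik}(u))²,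 and ν³ = ∫_{ℝᵈ∖{0}} (∫₀¹(1−τ)η''((1−τ)u(t,x)+τu(t,x+z))dτ)·(u(t,x+z)−u(t,x))² dπ(z). -/
open MeasureTheory Set intervalIntegral

noncomputable section

variable {d K : ℕ}

/-- Spatial partial derivative `∂_{x_i} g (x)`. -/
def pd (i : Fin d) (g : EuclideanSpace ℝ (Fin d) → ℝ) (x : EuclideanSpace ℝ (Fin d)) : ℝ :=
  fderiv ℝ g x (EuclideanSpace.single i 1)

/-- `ζ_{ik}(z) = ∫₀^z σ_{ik}(ξ) dξ`. -/
def zetaF (σ : ℝ → Fin d → Fin K → ℝ) (i : Fin d) (k : Fin K) (z : ℝ) : ℝ :=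
  ∫ ξ in (0:ℝ)..z, σ ξ i k

/-- Entropy flux `q` with `q' = η' f'` (componentwise). -/
def qF (f : ℝ → Fin d → ℝ) (η : ℝ → ℝ) (i : Fin d) (z : ℝ) : ℝ :=
  ∫ ξ in (0:ℝ)..z, deriv η ξ * deriv (fun s => f s i) ξ

/-- Entropy flux `r` with `r' = η' a`, `a = σ σᵀ` (componentwise). -/
def rF (σ : ℝ → Fin d → Fin K → ℝ) (η : ℝ → ℝ) (i j : Fin d) (z : ℝ) : ℝ :=
  ∫ ξ in (0:ℝ)..z, deriv η ξ * (∑ k, σ ξ i k * σ ξ j k)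

/-- The weight `|z|²·1_{|z|<1} + |z|·1_{|z|≥1}` against which a Lévy measure is finite. -/
def levyWeight (z : EuclideanSpace ℝ (Fin d)) : ℝ := if ‖z‖ < 1 then ‖z‖ ^ 2 else ‖z‖

lemma integrable_levyWeight {π : Measure (EuclideanSpace ℝ (Fin d))}
    (hπ : ∫⁻ z, ENNReal.ofReal (if ‖z‖ < 1 then ‖z‖ ^ 2 else ‖z‖) ∂π < ⊤) :
    Integrable (levyWeight (d := d)) π := by
  have hm : Measurable (levyWeight (d := d)) :=
    Measurable.ite (measurableSet_lt measurable_norm measurable_const)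
      (measurable_norm.pow_const 2) measurable_norm
  have h0 : ∀ z : EuclideanSpace ℝ (Fin d), 0 ≤ levyWeight z := fun z => by
    unfold levyWeight; split_ifs <;> positivity
  exact ⟨hm.aestronglyMeasurable,
    (hasFiniteIntegral_iff_ofReal (Filter.Eventually.of_forall h0)).2 hπ⟩

lemma norm_sub_le_of_fderiv_bound {E : Type*} [NormedAddCommGroup E] [NormedSpace ℝ E]
    {F : Type*} [NormedAddCommGroup F] [NormedSpace ℝ F]
    {v : E → F} {C : ℝ} (hv : Differentiable ℝ v) (h1 : ∀ x, ‖fderiv ℝ v x‖ ≤ C) (x z : E) :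
    ‖v (x + z) - v x‖ ≤ C * ‖z‖ := by
  simpa using convex_univ.norm_image_sub_le_of_norm_fderiv_le (𝕜 := ℝ) (f := v)
    (fun y _ => hv y) (fun y _ => h1 y) (mem_univ x) (mem_univ (x + z))

lemma abs_taylor_le_of_fderiv_bound {E : Type*} [NormedAddCommGroup E] [NormedSpace ℝ E]
    {v : E → ℝ} {C : ℝ} (hv : ContDiff ℝ 2 v)
    (h2 : ∀ x, ‖fderiv ℝ (fderiv ℝ v) x‖ ≤ C) (x z : E) :
    |v (x + z) - v x - fderiv ℝ v x z| ≤ C * ‖z‖ ^ 2 := by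
  have hd : Differentiable ℝ (fderiv ℝ v) :=
    (hv.fderiv_right (m := 1) (by norm_num)).differentiable (by norm_num)
  have hC : 0 ≤ C := (norm_nonneg (fderiv ℝ (fderiv ℝ v) x)).trans (h2 x)
  have h := (convex_closedBall x ‖z‖).norm_image_sub_le_of_norm_fderiv_le' (𝕜 := ℝ) (f := v)
    (φ := fderiv ℝ v x) (C := C * ‖z‖) (x := x) (y := x + z)
    (fun y _ => hv.differentiable (by norm_num) y)
    (fun y hy => by
      have := norm_sub_le_of_fderiv_bound hd h2 x (y - x)
      rw [add_sub_cancel] at this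
      refine this.trans (mul_le_mul_of_nonneg_left ?_ hC)
      simpa [dist_eq_norm] using hy)
    (by simp) (by simp)
  rw [add_sub_cancel_left, Real.norm_eq_abs] at h
  linarith [h, sq ‖z‖, mul_assoc C ‖z‖ ‖z‖]

/-- The integrand of `levyOp` is integrable for bounded-derivative `C²` functions. -/
lemma integrable_levyOp_integrand {π : Measure (EuclideanSpace ℝ (Fin d))}
    (hπ : ∫⁻ z, ENNReal.ofReal (if ‖z‖ < 1 then ‖z‖ ^ 2 else ‖z‖) ∂π < ⊤)
    {v : EuclideanSpace ℝ (Fin d) → ℝ} {C : ℝ} (hv : ContDiff ℝ 2 v)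
    (h1 : ∀ x, ‖fderiv ℝ v x‖ ≤ C) (h2 : ∀ x, ‖fderiv ℝ (fderiv ℝ v) x‖ ≤ C)
    (x : EuclideanSpace ℝ (Fin d)) :
    Integrable (fun z => v (x + z) - v x -
      Set.indicator (Metric.ball (0 : EuclideanSpace ℝ (Fin d)) 1)
        (fun w => fderiv ℝ v x w) z) π := by
  refine ((integrable_levyWeight hπ).const_mul C).mono' ?_ (Filter.Eventually.of_forall fun z => ?_)
  · have hc : Continuous fun z => v (x + z) - v x := by
      have := hv.continuous
      fun_prop
    exact (hc.measurable.sub ((fderiv ℝ v x).continuous.measurable.indicator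
      Metric.isOpen_ball.measurableSet)).aestronglyMeasurable
  · unfold levyWeight
    by_cases hz : ‖z‖ < 1
    · rw [indicator_of_mem (by simpa using hz), if_pos hz]
      exact abs_taylor_le_of_fderiv_bound hv h2 x z
    · rw [indicator_of_notMem (by simpa using hz), if_neg hz, sub_zero]
      exact norm_sub_le_of_fderiv_bound (hv.differentiable (by norm_num)) h1 x z

lemma integral_taylor_remainder {η : ℝ → ℝ} (hη : ContDiff ℝ 2 η) (a b : ℝ) :
    (∫ τ in (0:ℝ)..1, (1 - τ) * deriv (deriv η) ((1 - τ) * a + τ * b)) * (b - a) ^ 2 =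
      η b - η a - deriv η a * (b - a) := by
  have h1 : ContDiff ℝ 1 (deriv η) := hη.deriv'
  have h2 : Continuous (deriv (deriv η)) := h1.continuous_deriv (by norm_num)
  have hw : ∀ τ : ℝ, HasDerivAt (fun τ : ℝ => (1 - τ) * a + τ * b) (b - a) τ := fun τ => by
    have := (((hasDerivAt_id' τ).const_sub 1).mul_const a).add ((hasDerivAt_id' τ).mul_const b)
    exact this.congr_deriv (by ring)
  have hF : ∀ τ : ℝ, HasDerivAt (fun τ : ℝ => η ((1 - τ) * a + τ * b) +
      (1 - τ) * (b - a) * deriv η ((1 - τ) * a + τ * b))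
      ((1 - τ) * deriv (deriv η) ((1 - τ) * a + τ * b) * (b - a) ^ 2) τ := fun τ => by
    have e1 := ((hη.differentiable (by norm_num)) ((1 - τ) * a + τ * b)).hasDerivAt.comp τ (hw τ)
    have e2 := ((h1.differentiable (by norm_num)) ((1 - τ) * a + τ * b)).hasDerivAt.comp τ (hw τ)
    have e3 := ((hasDerivAt_id τ).const_sub 1).mul_const (b - a)
    refine (e1.add (e3.mul e2)).congr_deriv ?_
    simp only [Function.comp_apply, id]
    ring
  rw [← intervalIntegral.integral_mul_const,
    integral_eq_sub_of_hasDerivAt (fun τ _ => hF τ)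
      (Continuous.intervalIntegrable (by fun_prop) _ _)]
  simp
  ring

lemma integrable_levy_dissipation {π : Measure (EuclideanSpace ℝ (Fin d))}
    (hπ : ∫⁻ z, ENNReal.ofReal (if ‖z‖ < 1 then ‖z‖ ^ 2 else ‖z‖) ∂π < ⊤)
    {v : EuclideanSpace ℝ (Fin d) → ℝ} {C : ℝ} (hv : ContDiff ℝ 2 v)
    (h0 : ∀ x, |v x| ≤ C) (h1 : ∀ x, ‖fderiv ℝ v x‖ ≤ C)
    {η : ℝ → ℝ} (hη : ContDiff ℝ 2 η) (x : EuclideanSpace ℝ (Fin d)) :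
    Integrable (fun z => (∫ τ in (0:ℝ)..1,
      (1 - τ) * deriv (deriv η) ((1 - τ) * v x + τ * v (x + z))) * (v (x + z) - v x) ^ 2) π := by
  have hη1 : ContDiff ℝ 1 (deriv η) := hη.deriv'
  have hη2 : Continuous (deriv (deriv η)) := hη1.continuous_deriv (by norm_num)
  have hC : 0 ≤ C := (abs_nonneg _).trans (h0 x)
  obtain ⟨M, hM⟩ := (isCompact_Icc (a := -C) (b := C)).exists_bound_of_continuousOn hη2.continuousOn
  have hM0 : 0 ≤ M := (norm_nonneg _).trans (hM 0 ⟨by linarith, hC⟩)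
  refine ((integrable_levyWeight hπ).const_mul (M * (C ^ 2 + 2 * C * C))).mono' ?_
    (Filter.Eventually.of_forall fun z => ?_)
  · simp only [integral_taylor_remainder hη]
    have := hv.continuous
    have := hη.continuous
    exact Continuous.aestronglyMeasurable (by fun_prop)
  · have hI : ‖∫ τ in (0:ℝ)..1,
        (1 - τ) * deriv (deriv η) ((1 - τ) * v x + τ * v (x + z))‖ ≤ M := by
      have := intervalIntegral.norm_integral_le_of_norm_le_const (a := (0:ℝ)) (b := 1) (C := M)
        (f := fun τ => (1 - τ) * deriv (deriv η) ((1 - τ) * v x + τ * v (x + z))) ?_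
      · simpa using this
      intro τ hτ
      rw [uIoc_of_le zero_le_one] at hτ
      have hτ0 : 0 ≤ 1 - τ := by linarith [hτ.2]
      have hmem : (1 - τ) * v x + τ * v (x + z) ∈ Icc (-C) C :=
        convex_Icc (-C) C (abs_le.1 (h0 x)) (abs_le.1 (h0 (x + z))) hτ0 hτ.1.le (by ring)
      rw [norm_mul, Real.norm_of_nonneg hτ0]
      nlinarith [hM _ hmem, hτ.1, norm_nonneg (deriv (deriv η) ((1 - τ) * v x + τ * v (x + z)))]
    rw [norm_mul, mul_assoc, norm_pow, Real.norm_eq_abs (v (x + z) - v x)]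
    refine mul_le_mul hI ?_ (by positivity) hM0
    have hL : |v (x + z) - v x| ≤ C * ‖z‖ :=
      norm_sub_le_of_fderiv_bound (hv.differentiable (by norm_num)) h1 x z
    have hB : |v (x + z) - v x| ≤ 2 * C := by
      refine (abs_sub _ _).trans ?_
      linarith [h0 x, h0 (x + z)]
    have hn := norm_nonneg z
    have ha := abs_nonneg (v (x + z) - v x)
    unfold levyWeight
    split_ifs
    · calc |v (x + z) - v x| ^ 2 ≤ (C * ‖z‖) ^ 2 := by gcongr
        _ ≤ _ := by nlinarith [mul_nonneg (mul_nonneg hC hC) (sq_nonneg ‖z‖)]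
    · calc |v (x + z) - v x| ^ 2 ≤ (2 * C) * (C * ‖z‖) := by
            rw [sq]; exact mul_le_mul hB hL ha (by positivity)
        _ ≤ _ := by nlinarith [mul_nonneg (mul_nonneg hC hC) hn]

/-- Chain rule for the Lévy operator, with the exact second-order remainder. -/
lemma levyOp_comp {π : Measure (EuclideanSpace ℝ (Fin d))}
    (hπ : ∫⁻ z, ENNReal.ofReal (if ‖z‖ < 1 then ‖z‖ ^ 2 else ‖z‖) ∂π < ⊤)
    {v : EuclideanSpace ℝ (Fin d) → ℝ} {C : ℝ} (hv : ContDiff ℝ 2 v)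
    (h0 : ∀ x, |v x| ≤ C) (h1 : ∀ x, ‖fderiv ℝ v x‖ ≤ C)
    (h2 : ∀ x, ‖fderiv ℝ (fderiv ℝ v) x‖ ≤ C)
    {η : ℝ → ℝ} (hη : ContDiff ℝ 2 η) (x : EuclideanSpace ℝ (Fin d)) :
    levyOp π (fun y => η (v y)) x = deriv η (v x) * levyOp π v x +
      ∫ z, (∫ τ in (0:ℝ)..1, (1 - τ) * deriv (deriv η) ((1 - τ) * v x + τ * v (x + z))) *
        (v (x + z) - v x) ^ 2 ∂π := by
  unfold levyOp
  rw [← MeasureTheory.integral_const_mul, ← MeasureTheory.integral_add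
    ((integrable_levyOp_integrand hπ hv h1 h2 x).const_mul _)
    (integrable_levy_dissipation hπ hv h0 h1 hη x)]
  refine integral_congr_ae (Filter.Eventually.of_forall fun z => ?_)
  have hd : fderiv ℝ (fun y => η (v y)) x = deriv η (v x) • fderiv ℝ v x :=
    ((hη.differentiable (by norm_num) (v x)).hasDerivAt.comp_hasFDerivAt x
      (hv.differentiable (by norm_num) x).hasFDerivAt).fderiv
  simp only [integral_taylor_remainder hη, hd]
  by_cases hz : z ∈ Metric.ball (0 : EuclideanSpace ℝ (Fin d)) 1
  · simp only [indicator_of_mem hz, smul_apply, smul_eq_mul]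
    ring
  · simp only [indicator_of_notMem hz]
    ring

lemma pd_comp {g : ℝ → ℝ} {g' : ℝ} {v : EuclideanSpace ℝ (Fin d) → ℝ}
    {x : EuclideanSpace ℝ (Fin d)} (hg : HasDerivAt g g' (v x)) (hv : DifferentiableAt ℝ v x)
    (i : Fin d) : pd i (fun y => g (v y)) x = g' * pd i v x := by
  have h : fderiv ℝ (fun y => g (v y)) x = g' • fderiv ℝ v x :=
    (hg.comp_hasFDerivAt x hv.hasFDerivAt).fderiv
  simp [pd, h]

lemma pd_mul {g h : EuclideanSpace ℝ (Fin d) → ℝ} {x : EuclideanSpace ℝ (Fin d)}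
    (hg : DifferentiableAt ℝ g x) (hh : DifferentiableAt ℝ h x) (i : Fin d) :
    pd i (fun y => g y * h y) x = g x * pd i h x + pd i g x * h x := by
  simp only [pd, fderiv_fun_mul hg hh]
  simp [mul_comm]

lemma pd_sum {ι : Type*} [Fintype ι] {g : ι → EuclideanSpace ℝ (Fin d) → ℝ}
    {x : EuclideanSpace ℝ (Fin d)} (hg : ∀ j, DifferentiableAt ℝ (g j) x) (i : Fin d) :
    pd i (fun y => ∑ j, g j y) x = ∑ j, pd i (g j) x := by
  simp only [pd, fderiv_fun_sum (fun j _ => hg j)]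
  simp

lemma differentiable_pd {v : EuclideanSpace ℝ (Fin d) → ℝ} (hv : ContDiff ℝ 2 v) (i : Fin d) :
    Differentiable ℝ (pd i v) := by
  have hd : Differentiable ℝ (fderiv ℝ v) :=
    (hv.fderiv_right (m := 1) (by norm_num)).differentiable (by norm_num)
  unfold pd
  fun_prop

lemma hasDerivAt_primitive {g : ℝ → ℝ} (hg : Continuous g) (z : ℝ) :
    HasDerivAt (fun w => ∫ ξ in (0:ℝ)..w, g ξ) (g z) z :=
  integral_hasDerivAt_right (hg.intervalIntegrable _ _)
    hg.stronglyMeasurable.stronglyMeasurableAtFilter hg.continuousAt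

/-- **Entropy identity for smooth solutions of the regularized equation.** If `u` is a
bounded smooth solution of `∂ₜu + div f(u) = div(a(u)∇u) + L[u] + ρΔu` on `(0,T) × ℝᵈ`, then
for every `η ∈ C²(ℝ)` the entropy identity
`∂ₜη(u) + div q(u) = Σ_{ij}∂²_{ij}r_{ij}(u) + L[η(u)] + ρΔη(u) − (ν¹ + ν² + ν³)`
holds pointwise on `(0,T) × ℝᵈ`. -/
theorem entropy_identity_regularized
    (T ρ : ℝ) (hT : 0 < T) (hρ : 0 < ρ)
    (f : ℝ → Fin d → ℝ) (hf : ∀ i, ContDiff ℝ 1 (fun s => f s i))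
    (σ : ℝ → Fin d → Fin K → ℝ) (hσ : ∀ i k, ContDiff ℝ 1 (fun s => σ s i k))
    (π : Measure (EuclideanSpace ℝ (Fin d))) [SigmaFinite π]
    (hπ0 : π {0} = 0)
    (hπint : ∫⁻ z, ENNReal.ofReal (if ‖z‖ < 1 then ‖z‖ ^ 2 else ‖z‖) ∂π < ⊤)
    (u : ℝ → EuclideanSpace ℝ (Fin d) → ℝ)
    (hub : ∃ C, ∀ t ∈ Set.Ioo (0:ℝ) T, ∀ x, |u t x| ≤ C ∧
      ‖fderiv ℝ (u t) x‖ ≤ C ∧ ‖fderiv ℝ (fderiv ℝ (u t)) x‖ ≤ C)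
    (hux : ∀ t ∈ Set.Ioo (0:ℝ) T, ContDiff ℝ 2 (u t))
    (hut : ∀ x, ContDiffOn ℝ 1 (fun s => u s x) (Set.Ioo (0:ℝ) T))
    (heq : ∀ t ∈ Set.Ioo (0:ℝ) T, ∀ x,
      deriv (fun s => u s x) t + ∑ i, pd i (fun y => f (u t y) i) x =
        (∑ i, pd i (fun y => ∑ j, (∑ k, σ (u t y) i k * σ (u t y) j k) * pd j (u t) y) x)
          + levyOp π (u t) x + ρ * ∑ i, pd i (fun y => pd i (u t) y) x)
    (η : ℝ → ℝ) (hη : ContDiff ℝ 2 η) :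
    ∀ t ∈ Set.Ioo (0:ℝ) T, ∀ x,
      deriv (fun s => η (u s x)) t + ∑ i, pd i (fun y => qF f η i (u t y)) x =
        (∑ i, ∑ j, pd i (fun y => pd j (fun y' => rF σ η i j (u t y')) y) x)
          + levyOp π (fun y => η (u t y)) x
          + ρ * ∑ i, pd i (fun y => pd i (fun y' => η (u t y')) y) x
          - (ρ * deriv (deriv η) (u t x) * ∑ i, (pd i (u t) x) ^ 2
            + deriv (deriv η) (u t x) *
              ∑ k, (∑ i, pd i (fun y => zetaF σ i k (u t y)) x) ^ 2
            + ∫ z, (∫ τ in (0:ℝ)..1,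
                  (1 - τ) * deriv (deriv η) ((1 - τ) * u t x + τ * u t (x + z))) *
                (u t (x + z) - u t x) ^ 2 ∂π) := by
  intro t ht x
  obtain ⟨C, hC⟩ := hub
  have hv := hux t ht
  have hvd : Differentiable ℝ (u t) := hv.differentiable (by norm_num)
  have hη0 : Differentiable ℝ η := hη.differentiable (by norm_num)
  have hη1 : ContDiff ℝ 1 (deriv η) := hη.deriv'
  have hη1d : Differentiable ℝ (deriv η) := hη1.differentiable (by norm_num)
  have ha : ∀ i j, Differentiable ℝ fun s => ∑ k, σ s i k * σ s j k := fun i j =>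
    Differentiable.fun_sum fun k _ => ((hσ i k).differentiable (by norm_num)).mul
      ((hσ j k).differentiable (by norm_num))
  have hau : ∀ i j, Differentiable ℝ fun y => ∑ k, σ (u t y) i k * σ (u t y) j k := fun i j =>
    (ha i j).comp hvd
  have htime : deriv (fun s => η (u s x)) t = deriv η (u t x) * deriv (fun s => u s x) t :=
    ((hη0 (u t x)).hasDerivAt.comp t (((hut x).differentiableOn (by norm_num)).differentiableAt
      (isOpen_Ioo.mem_nhds ht)).hasDerivAt).deriv
  have hflux : ∀ i, pd i (fun y => qF f η i (u t y)) x =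
      deriv η (u t x) * pd i (fun y => f (u t y) i) x := fun i => by
    rw [pd_comp (((hf i).differentiable (by norm_num)) (u t x)).hasDerivAt (hvd x) i,
      pd_comp (g := qF f η i) (hasDerivAt_primitive
        (hη1.continuous.mul ((hf i).continuous_deriv (by norm_num))) _) (hvd x), Pi.mul_apply, mul_assoc]
  have hentropy : ∀ i y, pd i (fun y' => η (u t y')) y = deriv η (u t y) * pd i (u t) y :=
    fun i y => pd_comp (hη0 (u t y)).hasDerivAt (hvd y) i
  have hη1u : Differentiable ℝ fun y => deriv η (u t y) := hη1d.comp hvd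
  have hη1pd : ∀ i, pd i (fun y => deriv η (u t y)) x =
      deriv (deriv η) (u t x) * pd i (u t) x := fun i =>
    pd_comp (hη1d (u t x)).hasDerivAt (hvd x) i
  have hlap : ∀ i, pd i (fun y => pd i (fun y' => η (u t y')) y) x =
      deriv η (u t x) * pd i (fun y => pd i (u t) y) x +
        deriv (deriv η) (u t x) * pd i (u t) x ^ 2 := fun i => by
    simp only [hentropy]
    rw [pd_mul (hη1u x) (differentiable_pd hv i x), hη1pd]
    ring
  have hr : ∀ i j y, pd j (fun y' => rF σ η i j (u t y')) y =
      deriv η (u t y) * ((∑ k, σ (u t y) i k * σ (u t y) j k) * pd j (u t) y) := fun i j y => by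
    rw [pd_comp (g := rF σ η i j) (hasDerivAt_primitive
        (hη1.continuous.mul (ha i j).continuous) _) (hvd y), Pi.mul_apply, mul_assoc]
  have hdiff : ∀ i, ∑ j, pd i (fun y => pd j (fun y' => rF σ η i j (u t y')) y) x =
      deriv η (u t x) *
        pd i (fun y => ∑ j, (∑ k, σ (u t y) i k * σ (u t y) j k) * pd j (u t) y) x +
      deriv (deriv η) (u t x) * ∑ k, ∑ j,
        (σ (u t x) i k * pd i (u t) x) * (σ (u t x) j k * pd j (u t) x) := fun i => by
    have hs : ∀ j, Differentiable ℝ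
        fun y => (∑ k, σ (u t y) i k * σ (u t y) j k) * pd j (u t) y := fun j =>
      (hau i j).mul (differentiable_pd hv j)
    rw [pd_sum (fun j => hs j x), Finset.sum_comm, Finset.mul_sum, Finset.mul_sum,
      ← Finset.sum_add_distrib]
    refine Finset.sum_congr rfl fun j _ => ?_
    simp only [hr]
    rw [pd_mul (hη1u x) (hs j x), hη1pd, add_right_inj, mul_assoc]
    congr 1
    rw [Finset.sum_mul, Finset.mul_sum]
    exact Finset.sum_congr rfl fun k _ => by ring
  have hzeta : ∀ k i, pd i (fun y => zetaF σ i k (u t y)) x =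
      σ (u t x) i k * pd i (u t) x := fun k i =>
    pd_comp (g := zetaF σ i k) (hasDerivAt_primitive (hσ i k).continuous _) (hvd x) i
  have hsq : ∑ k, (∑ i, pd i (fun y => zetaF σ i k (u t y)) x) ^ 2 = ∑ i, ∑ k, ∑ j,
      (σ (u t x) i k * pd i (u t) x) * (σ (u t x) j k * pd j (u t) x) := by
    rw [Finset.sum_comm]
    refine Finset.sum_congr rfl fun k _ => ?_
    simp only [hzeta, sq, Finset.sum_mul_sum]
  rw [htime, hsq, levyOp_comp hπint hv (fun y => (hC t ht y).1) (fun y => (hC t ht y).2.1)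
    (fun y => (hC t ht y).2.2) hη x]
  simp only [hflux, hdiff, hlap, Finset.sum_add_distrib, ← Finset.mul_sum]
  linear_combination deriv η (u t x) * heq t ht x
end
end

section
/- (Second-order duality estimate.) Let w : ℝᵈ → ℝ be bounded and C¹ with ∇w ∈ L¹(ℝᵈ;ℝᵈ), and let ψ ∈ C_c^∞(ℝᵈ). Then for every z ∈ ℝᵈ: |∫_{ℝᵈ} w(x)·(ψ(x+z) − ψ(x) − ∇ψ(x)·z) dx| ≤ (1/2)·|z|²·‖∇w‖_{L¹(ℝᵈ)}·‖∇ψ‖_{L^∞(ℝᵈ)}. -/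
open MeasureTheory

/-- Translating a compactly supported function keeps its support compact. -/
lemma HasCompactSupport.comp_add_const {G β : Type*} [TopologicalSpace G] [AddGroup G]
    [ContinuousAdd G] [Zero β] {f : G → β} (hf : HasCompactSupport f) (a : G) :
    HasCompactSupport (fun x => f (x + a)) :=
  hf.comp_homeomorph (Homeomorph.addRight a)

section Translates

variable {E : Type*} [NormedAddCommGroup E] [NormedSpace ℝ E]
  [FiniteDimensional ℝ E] [MeasurableSpace E] [BorelSpace E]
  {μ : Measure E} [μ.IsAddHaarMeasure]

/-- Differentiation under the integral sign along a line of translates of a `C¹` function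
with compact support. -/
lemma hasDerivAt_integral_mul_comp_add_smul {w ψ : E → ℝ} (hw : Continuous w)
    (hψ : ContDiff ℝ 1 ψ) (hψc : HasCompactSupport ψ) (z : E) (t : ℝ) :
    HasDerivAt (fun s : ℝ => ∫ x, w x * ψ (x + s • z) ∂μ)
      (∫ x, w x * fderiv ℝ ψ (x + t • z) z ∂μ) t := by
  have hψ' : Continuous (fderiv ℝ ψ) := hψ.continuous_fderiv one_ne_zero
  obtain ⟨R, hR⟩ := (hψc.fderiv ℝ).isCompact.isBounded.subset_closedBall 0
  obtain ⟨C, hC⟩ := (hψc.fderiv ℝ).exists_bound_of_continuous hψ'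
  set K : Set E := Metric.closedBall 0 (R + (|t| + 1) * ‖z‖) with hK
  have hKc : IsCompact K := isCompact_closedBall _ _
  refine (hasDerivAt_integral_of_dominated_loc_of_deriv_le (𝕜 := ℝ) (μ := μ)
    (F := fun s x => w x * ψ (x + s • z))
    (F' := fun s x => w x * fderiv ℝ ψ (x + s • z) z)
    (bound := K.indicator fun x => |w x| * (C * ‖z‖))
    (Metric.ball_mem_nhds t one_pos) ?_ ?_ ?_ ?_ ?_ ?_).2
  · refine .of_forall fun s => Continuous.aestronglyMeasurable ?_
    have := hψ.continuous
    fun_prop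
  · refine Continuous.integrable_of_hasCompactSupport ?_ (hψc.comp_add_const _).mul_left
    have := hψ.continuous
    fun_prop
  · refine Continuous.aestronglyMeasurable ?_
    fun_prop
  · refine .of_forall fun x s hs => ?_
    by_cases hx : x ∈ K
    · rw [Set.indicator_of_mem hx, norm_mul, Real.norm_eq_abs]
      gcongr
      exact (ContinuousLinearMap.le_opNorm _ _).trans (by gcongr; exact hC _)
    · have h0 : fderiv ℝ ψ (x + s • z) = 0 := by
        by_contra h
        have h1 := hR (subset_tsupport _ h)
        rw [mem_closedBall_zero_iff] at h1
        rw [hK, mem_closedBall_zero_iff, not_le] at hx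
        rw [Metric.mem_ball, Real.dist_eq] at hs
        have h2 : |s| ≤ |t| + 1 := by
          have := abs_sub_abs_le_abs_sub s t
          linarith
        have h3 : ‖x‖ ≤ ‖x + s • z‖ + |s| * ‖z‖ := by
          simpa [norm_smul] using norm_sub_le (x + s • z) (s • z)
        have h4 := mul_le_mul_of_nonneg_right h2 (norm_nonneg z)
        linarith
      simp [hx, h0]
  · refine (integrable_indicator_iff hKc.measurableSet).2 (ContinuousOn.integrableOn_compact hKc ?_)
    fun_prop
  · refine .of_forall fun x s _ => HasDerivAt.const_mul _ ?_
    have h1 : HasDerivAt (fun s : ℝ => x + s • z) z s := by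
      simpa using ((hasDerivAt_id s).smul_const z).const_add x
    exact ((hψ.differentiable one_ne_zero) _).hasFDerivAt.comp_hasDerivAt s h1

/-- Integration by parts against a translate of a `C¹` function with compact support. -/
lemma integral_mul_fderiv_comp_add {w ψ : E → ℝ} (hw : ContDiff ℝ 1 w)
    (hψ : ContDiff ℝ 1 ψ) (hψc : HasCompactSupport ψ) (a z : E) :
    ∫ x, w x * fderiv ℝ ψ (x + a) z ∂μ = -∫ x, fderiv ℝ w x z * ψ (x + a) ∂μ := by
  have hw' : Continuous (fderiv ℝ w) := hw.continuous_fderiv one_ne_zero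
  have hψ' : Continuous (fderiv ℝ ψ) := hψ.continuous_fderiv one_ne_zero
  have hwc := hw.continuous
  have hψc' := hψ.continuous
  have h := integral_mul_fderiv_eq_neg_fderiv_mul_of_integrable (μ := μ) (𝕜 := ℝ) (f := w)
    (g := fun x => ψ (x + a)) (v := z) ?_ ?_ ?_ (fun x _ => hw.differentiable one_ne_zero x)
    (fun x _ => by have := hψ.differentiable one_ne_zero; fun_prop)
  · simpa only [fderiv_comp_add_right] using h
  · exact Continuous.integrable_of_hasCompactSupport (by fun_prop) (hψc.comp_add_const a).mul_left
  · simp only [fderiv_comp_add_right]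
    exact Continuous.integrable_of_hasCompactSupport (by fun_prop)
      ((hψc.fderiv_apply ℝ z).comp_add_const a).mul_left
  · exact Continuous.integrable_of_hasCompactSupport (by fun_prop) (hψc.comp_add_const a).mul_left

end Translates

/-- **Second-order duality estimate.** For `w` bounded `C¹` with integrable gradient and
`ψ ∈ C_c^∞(ℝᵈ)`, for every `z`:
`|∫ w(x)·(ψ(x+z) − ψ(x) − ∇ψ(x)·z) dx| ≤ (1/2)·|z|²·‖∇w‖_{L¹}·‖∇ψ‖_{L∞}`,
where `Cψ` is any uniform bound on `‖∇ψ‖`. -/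
theorem second_order_duality_estimate {d : ℕ}
    (w : EuclideanSpace ℝ (Fin d) → ℝ) (hw : ContDiff ℝ 1 w)
    (hwb : ∃ C, ∀ x, |w x| ≤ C)
    (hw1 : Integrable (fun x => ‖fderiv ℝ w x‖))
    (ψ : EuclideanSpace ℝ (Fin d) → ℝ) (hψ : ContDiff ℝ (⊤ : ℕ∞) ψ)
    (hψc : HasCompactSupport ψ)
    (Cψ : ℝ) (hCψ : ∀ x, ‖fderiv ℝ ψ x‖ ≤ Cψ)
    (z : EuclideanSpace ℝ (Fin d)) :
    |∫ x, w x * (ψ (x + z) - ψ x - fderiv ℝ ψ x z)| ≤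
      (1 / 2) * ‖z‖ ^ 2 * (∫ x, ‖fderiv ℝ w x‖) * Cψ := by
  have hψ1 : ContDiff ℝ 1 ψ := hψ.of_le (by exact_mod_cast le_top)
  have hwc := hw.continuous
  have hψ0 := hψ.continuous
  have hw' : Continuous (fderiv ℝ w) := hw.continuous_fderiv one_ne_zero
  have hψ' : Continuous (fderiv ℝ ψ) := hψ1.continuous_fderiv one_ne_zero
  set G : ℝ → ℝ := fun t => ∫ x, w x * ψ (x + t • z) with hG
  set D : ℝ → ℝ := fun t => ∫ x, w x * fderiv ℝ ψ (x + t • z) z with hD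
  set I : ℝ := ∫ x, ‖fderiv ℝ w x‖ with hI
  have hGD (t : ℝ) : HasDerivAt G (D t) t :=
    hasDerivAt_integral_mul_comp_add_smul hwc hψ1 hψc z t
  have hint (a : EuclideanSpace ℝ (Fin d)) : Integrable fun x => w x * ψ (x + a) :=
    Continuous.integrable_of_hasCompactSupport (by fun_prop) (hψc.comp_add_const a).mul_left
  have hint' (a : EuclideanSpace ℝ (Fin d)) : Integrable fun x => fderiv ℝ w x z * ψ (x + a) :=
    Continuous.integrable_of_hasCompactSupport (by fun_prop) (hψc.comp_add_const a).mul_left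
  have hintD : Integrable fun x => w x * fderiv ℝ ψ x z :=
    Continuous.integrable_of_hasCompactSupport (by fun_prop) (hψc.fderiv_apply ℝ z).mul_left
  have hlip (x y : EuclideanSpace ℝ (Fin d)) : ‖ψ y - ψ x‖ ≤ Cψ * ‖y - x‖ :=
    Convex.norm_image_sub_le_of_norm_fderiv_le (𝕜 := ℝ)
      (fun x _ => hψ1.differentiable one_ne_zero x) (fun x _ => hCψ x) convex_univ
      (Set.mem_univ x) (Set.mem_univ y)
  have hbound (t : ℝ) (ht : 0 ≤ t) : ‖D t - D 0‖ ≤ ‖z‖ ^ 2 * I * Cψ * t := by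
    have h1 : D t - D 0 = -∫ x, fderiv ℝ w x z * (ψ (x + t • z) - ψ x) := by
      have h0 := hint' 0
      simp only [add_zero] at h0
      simp only [hD, integral_mul_fderiv_comp_add hw hψ1 hψc, mul_sub]
      rw [integral_sub (hint' _) h0]
      simp only [zero_smul, add_zero]
      ring
    rw [h1, norm_neg]
    calc ‖∫ x, fderiv ℝ w x z * (ψ (x + t • z) - ψ x)‖
        ≤ ∫ x, ‖fderiv ℝ w x‖ * (‖z‖ ^ 2 * Cψ * t) := by
          refine norm_integral_le_of_norm_le (hw1.mul_const _) (.of_forall fun x => ?_)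
          have h2 : ‖ψ (x + t • z) - ψ x‖ ≤ Cψ * (t * ‖z‖) := by
            simpa [norm_smul, abs_of_nonneg ht] using hlip x (x + t • z)
          calc ‖fderiv ℝ w x z * (ψ (x + t • z) - ψ x)‖
              ≤ (‖fderiv ℝ w x‖ * ‖z‖) * (Cψ * (t * ‖z‖)) := by
                rw [norm_mul]
                gcongr
                exact ContinuousLinearMap.le_opNorm _ _
            _ = ‖fderiv ℝ w x‖ * (‖z‖ ^ 2 * Cψ * t) := by ring
      _ = ‖z‖ ^ 2 * I * Cψ * t := by rw [integral_mul_const]; ring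
  have hderiv (t : ℝ) : HasDerivAt (fun t => G t - G 0 - t * D 0) (D t - D 0) t := by
    simpa using ((hGD t).sub_const (G 0)).fun_sub ((hasDerivAt_id t).mul_const (D 0))
  have hB (t : ℝ) : HasDerivAt (fun t => ‖z‖ ^ 2 * I * Cψ * (t ^ 2 / 2))
      (‖z‖ ^ 2 * I * Cψ * t) t := by
    simpa using (((hasDerivAt_pow 2 t).div_const 2).const_mul (‖z‖ ^ 2 * I * Cψ))
  have hmain := image_norm_le_of_norm_deriv_right_le_deriv_boundary (a := 0) (b := 1)
    (fun t _ => (hderiv t).continuousAt.continuousWithinAt)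
    (fun t _ => (hderiv t).hasDerivWithinAt) (by simp) hB
    (fun t ht => hbound t ht.1) (Set.right_mem_Icc.2 zero_le_one)
  have heq : ∫ x, w x * (ψ (x + z) - ψ x - fderiv ℝ ψ x z) = G 1 - G 0 - 1 * D 0 := by
    have h0 := hint 0
    simp only [add_zero] at h0
    simp only [hG, hD, mul_sub, one_smul, zero_smul, add_zero, one_mul]
    rw [integral_sub (by exact (hint z).sub h0) hintD, integral_sub (hint z) h0]
  rw [heq, ← Real.norm_eq_abs]
  exact hmain.trans_eq (by ring)
end
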